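/- arXiv:2011.09135 — 2 statements merged into one kernel-verified Lean document; each statement's English description precedes it below -/
import Mathlib

section
/- For each match (k,i,j) ∈ M, the inequality x_{k,i,j} ≥ 0 is facet-defining for Ptt(n). -/
open Finset

attribute [local instance] Classical.propDecidable

namespace TTP

/-- `(k,i,j)` is a valid match index: slot `k ∈ S = {1,…,2n-2}`, home venue `i` and
away team `j` are distinct elements of `V = {1,…,n}`. -/
def IsMatch (n : ℕ) (m : ℕ × ℕ × ℕ) : Prop :=
  1 ≤ m.1 ∧ m.1 ≤ 2 * n - 2 ∧ 1 ≤ m.2.1 ∧ m.2.1 ≤ n ∧ 1 ≤ m.2.2 ∧ m.2.2 ≤ n ∧ m.2.1 ≠ m.2.2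

/-- `(t,i,j)` is a valid travel index: `t ∈ V` and `(i,j) ∈ A`. -/
def IsTravelIdx (n : ℕ) (p : ℕ × ℕ × ℕ) : Prop :=
  1 ≤ p.1 ∧ p.1 ≤ n ∧ 1 ≤ p.2.1 ∧ p.2.1 ≤ n ∧ 1 ≤ p.2.2 ∧ p.2.2 ≤ n ∧ p.2.1 ≠ p.2.2

/-- A (double round-robin) tournament: a set of matches such that in every slot every team
plays exactly once, and every ordered pair of distinct teams meets exactly once. -/
structure IsTournament (n : ℕ) (T : Set (ℕ × ℕ × ℕ)) : Prop where
  subset : ∀ m ∈ T, IsMatch n m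
  slot_team : ∀ k, 1 ≤ k → k ≤ 2 * n - 2 → ∀ t, 1 ≤ t → t ≤ n →
      ∃! m : ℕ × ℕ × ℕ, m ∈ T ∧ m.1 = k ∧ (t = m.2.1 ∨ t = m.2.2)
  pair : ∀ i j, 1 ≤ i → i ≤ n → 1 ≤ j → j ≤ n → i ≠ j → ∃! k : ℕ, (k, i, j) ∈ T

/-- The venue of team `t` in slot `k`: the home venue of the (unique) match of `t` in
slot `k`, and `t` itself if `t` has no match in slot `k` (in particular in the artificial
slots `0` and `2n-1`). -/
noncomputable def venue (T : Set (ℕ × ℕ × ℕ)) (t k : ℕ) : ℕ :=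
  if h : ∃ i, ∃ j, (k, i, j) ∈ T ∧ (t = i ∨ t = j) then h.choose else t

/-- The travel vector `ψ(T)`: `travel n T (t,i,j) = 1` iff for some `0 ≤ k ≤ 2n-2` team `t`
has venue `i` in slot `k` and venue `j` in slot `k+1`. -/
noncomputable def travel (n : ℕ) (T : Set (ℕ × ℕ × ℕ)) (p : ℕ × ℕ × ℕ) : ℝ :=
  if ∃ k, k ≤ 2 * n - 2 ∧ venue T p.1 k = p.2.1 ∧ venue T p.1 (k + 1) = p.2.2 then 1 else 0

/-- The play vector `χ(T)`: characteristic vector of `T`. -/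
noncomputable def play (T : Set (ℕ × ℕ × ℕ)) (m : ℕ × ℕ × ℕ) : ℝ :=
  if m ∈ T then 1 else 0

/-- The ambient space `ℝ^M × ℝ^{V×A}`. -/
abbrev Pt (n : ℕ) :=
  ({m : ℕ × ℕ × ℕ // IsMatch n m} → ℝ) × ({p : ℕ × ℕ × ℕ // IsTravelIdx n p} → ℝ)

/-- The play coordinate `x_{k,i,j}` of a point (0 at invalid indices). -/
noncomputable def xval {n : ℕ} (z : Pt n) (k i j : ℕ) : ℝ :=
  if h : IsMatch n (k, i, j) then z.1 ⟨(k, i, j), h⟩ else 0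

/-- The travel coordinate `y_{t,i,j}` of a point (0 at invalid indices). -/
noncomputable def yval {n : ℕ} (z : Pt n) (t i j : ℕ) : ℝ :=
  if h : IsTravelIdx n (t, i, j) then z.2 ⟨(t, i, j), h⟩ else 0

/-- The unconstrained traveling tournament polytope `Ptt(n)`:
the convex hull of all pairs `(χ(T), y)` with `T` a tournament and `y ∈ {0,1}^{V×A}`,
`y ≥ ψ(T)` componentwise. -/
def Ptt (n : ℕ) : Set (Pt n) :=
  convexHull ℝ { z : Pt n | ∃ T : Set (ℕ × ℕ × ℕ), IsTournament n T ∧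
    (∀ m : {m : ℕ × ℕ × ℕ // IsMatch n m}, z.1 m = play T m.1) ∧
    (∀ p : {p : ℕ × ℕ × ℕ // IsTravelIdx n p}, z.2 p = 0 ∨ z.2 p = 1) ∧
    (∀ p : {p : ℕ × ℕ × ℕ // IsTravelIdx n p}, travel n T p.1 ≤ z.2 p) }

/-- Dimension of the affine hull of a set. -/
noncomputable def adim {n : ℕ} (s : Set (Pt n)) : ℕ :=
  Module.finrank ℝ (affineSpan ℝ s).direction

/-- A valid inequality `f z ≤ γ` is facet-defining for `Ptt(n)`:
it holds on `Ptt(n)` and its face has dimension `dim Ptt(n) - 1`. -/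
def IsFacetLE {n : ℕ} (f : Pt n → ℝ) (γ : ℝ) : Prop :=
  (∀ z ∈ Ptt n, f z ≤ γ) ∧ adim {z ∈ Ptt n | f z = γ} + 1 = adim (Ptt n)

/-- A valid inequality `f z ≥ γ` is facet-defining for `Ptt(n)`:
it holds on `Ptt(n)` and its face has dimension `dim Ptt(n) - 1`. -/
def IsFacetGE {n : ℕ} (f : Pt n → ℝ) (γ : ℝ) : Prop :=
  (∀ z ∈ Ptt n, γ ≤ f z) ∧ adim {z ∈ Ptt n | f z = γ} + 1 = adim (Ptt n)


section Tournaments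

variable {n : ℕ} {T : Set (ℕ × ℕ × ℕ)}

theorem IsTournament.slot_unique (hT : IsTournament n T) {k l i j : ℕ}
    (h : (k, i, j) ∈ T) (h' : (l, i, j) ∈ T) : k = l := by
  obtain ⟨-, -, h1, h2, h3, h4, h5⟩ := hT.subset _ h
  exact (hT.pair i j h1 h2 h3 h4 h5).unique h h'

theorem IsTournament.match_unique (hT : IsTournament n T) {k t i j i' j' : ℕ}
    (h : (k, i, j) ∈ T) (h' : (k, i', j') ∈ T) (ht : t = i ∨ t = j) (ht' : t = i' ∨ t = j') :
    i = i' ∧ j = j' := by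
  obtain ⟨h0, h0', h1, h2, h3, h4, h5⟩ := hT.subset _ h
  have := (hT.slot_team k h0 h0' t (by rcases ht with rfl | rfl <;> assumption)
    (by rcases ht with rfl | rfl <;> assumption)).unique ⟨h, rfl, ht⟩ ⟨h', rfl, ht'⟩
  simpa using this

/-- Relabelling matches so that the slots are permuted and the teams of each match are kept
preserves the condition that every team plays exactly once in every slot. -/
theorem IsTournament.preimage (hT : IsTournament n T) (f : ℕ × ℕ × ℕ → ℕ × ℕ × ℕ)
    (hf : Function.Involutive f) (σ : ℕ → ℕ) (hσ : ∀ m, (f m).1 = σ m.1)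
    (hσr : ∀ k, 1 ≤ k → k ≤ 2 * n - 2 → 1 ≤ σ k ∧ σ k ≤ 2 * n - 2)
    (hteam : ∀ m t, (t = (f m).2.1 ∨ t = (f m).2.2) ↔ (t = m.2.1 ∨ t = m.2.2))
    (hmatch : ∀ m, IsMatch n m → IsMatch n (f m))
    (hpair : ∀ i j, 1 ≤ i → i ≤ n → 1 ≤ j → j ≤ n → i ≠ j → ∃! k : ℕ, f (k, i, j) ∈ T) :
    IsTournament n {m | f m ∈ T} where
  subset m hm := by simpa [hf m] using hmatch _ (hT.subset _ hm)
  slot_team k hk hk' t ht ht' := by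
    obtain ⟨h1, h2⟩ := hσr k hk hk'
    obtain ⟨m, ⟨hm, hmk, hmt⟩, huniq⟩ := hT.slot_team (σ k) h1 h2 t ht ht'
    have hσσ : σ (σ k) = k := by
      have := hσ (f (k, 0, 0))
      rw [hf, hσ] at this
      exact this.symm
    refine ⟨f m, ⟨by simpa [hf m] using hm, by rw [hσ, hmk, hσσ], (hteam m t).2 hmt⟩, ?_⟩
    rintro m' ⟨hm', rfl, hmt'⟩
    rw [← huniq (f m') ⟨hm', hσ m', (hteam m' t).2 hmt'⟩, hf]
  pair := hpair

/-- The schedule obtained by exchanging slots `u` and `v`. -/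
def swapSlots (u v : ℕ) (T : Set (ℕ × ℕ × ℕ)) : Set (ℕ × ℕ × ℕ) :=
  {m | (Equiv.swap u v m.1, m.2) ∈ T}

theorem mem_swapSlots {u v k i j : ℕ} :
    (k, i, j) ∈ swapSlots u v T ↔ (Equiv.swap u v k, i, j) ∈ T := Iff.rfl

theorem IsTournament.swapSlots (hT : IsTournament n T) {u v : ℕ} (hu : 1 ≤ u)
    (hu' : u ≤ 2 * n - 2) (hv : 1 ≤ v) (hv' : v ≤ 2 * n - 2) :
    IsTournament n (swapSlots u v T) := by
  have hr : ∀ k, 1 ≤ k → k ≤ 2 * n - 2 →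
      1 ≤ Equiv.swap u v k ∧ Equiv.swap u v k ≤ 2 * n - 2 := by
    intro k hk hk'
    rw [Equiv.swap_apply_def]
    split_ifs <;> omega
  refine hT.preimage (fun m => (Equiv.swap u v m.1, m.2)) (fun m => by simp)
    (Equiv.swap u v) (fun m => rfl) hr (fun m t => Iff.rfl) ?_ ?_
  · rintro ⟨k, i, j⟩ ⟨h1, h2, h3⟩
    exact ⟨(hr k h1 h2).1, (hr k h1 h2).2, h3⟩
  · intro i j h1 h2 h3 h4 h5
    obtain ⟨k, hk, huniq⟩ := hT.pair i j h1 h2 h3 h4 h5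
    refine ⟨Equiv.swap u v k, by simpa using hk, fun k' hk' => ?_⟩
    rw [← huniq _ hk', Equiv.swap_apply_self]

/-- The schedule obtained by exchanging the venues of the matches between `i` and `j` in the
slots `k` and `l`. -/
def swapHome (k l i j : ℕ) (T : Set (ℕ × ℕ × ℕ)) : Set (ℕ × ℕ × ℕ) :=
  {m | (if (m.1 = k ∨ m.1 = l) ∧ (m.2 = (i, j) ∨ m.2 = (j, i)) then (m.1, m.2.swap) else m) ∈ T}

theorem IsTournament.swapHome (hT : IsTournament n T) {k l i j : ℕ} (hk : (k, i, j) ∈ T)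
    (hl : (l, j, i) ∈ T) : IsTournament n (swapHome k l i j T) := by
  obtain ⟨-, -, -, -, -, -, hij⟩ := hT.subset _ hk
  simp only at hij
  refine hT.preimage _ ?_ id ?_ (fun k hk hk' => ⟨hk, hk'⟩) ?_ ?_ ?_
  · rintro ⟨s, a, b⟩
    by_cases h : (s = k ∨ s = l) ∧ ((a, b) = (i, j) ∨ (a, b) = (j, i))
    · have h' : (s = k ∨ s = l) ∧ ((b, a) = (i, j) ∨ (b, a) = (j, i)) := by
        simp only [Prod.mk.injEq] at h ⊢
        tauto
      dsimp only
      rw [if_pos h, Prod.swap_prod_mk, if_pos h']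
      rfl
    · dsimp only
      rw [if_neg h, if_neg h]
  · rintro ⟨s, a, b⟩
    dsimp only
    split_ifs <;> rfl
  · rintro ⟨s, a, b⟩ t
    dsimp only
    split_ifs
    · exact or_comm
    · rfl
  · rintro ⟨s, a, b⟩ ⟨h1, h2, h3, h4, h5, h6, h7⟩
    dsimp only
    split_ifs
    · exact ⟨h1, h2, h5, h6, h3, h4, h7.symm⟩
    · exact ⟨h1, h2, h3, h4, h5, h6, h7⟩
  · intro a b h1 h2 h3 h4 h5
    by_cases hab : (a = i ∧ b = j)
    · obtain ⟨rfl, rfl⟩ := hab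
      refine ⟨l, by simpa using hl, fun s hs => ?_⟩
      by_cases h : s = k ∨ s = l
      · simp only [h, true_or, and_self, if_true, Prod.swap_prod_mk] at hs
        exact hT.slot_unique hs hl
      · simp only [h, false_and, if_false] at hs
        exact absurd (Or.inl (hT.slot_unique hs hk)) h
    by_cases hab' : (a = j ∧ b = i)
    · obtain ⟨rfl, rfl⟩ := hab'
      refine ⟨k, by simpa using hk, fun s hs => ?_⟩
      by_cases h : s = k ∨ s = l
      · simp only [h, or_true, and_self, if_true, Prod.swap_prod_mk] at hs
        exact hT.slot_unique hs hk
      · simp only [h, false_and, if_false] at hs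
        exact absurd (Or.inr (hT.slot_unique hs hl)) h
    · simpa [hab, hab'] using hT.pair a b h1 h2 h3 h4 h5

theorem IsTournament.slots_ne (hT : IsTournament n T) {k l i j : ℕ} (hk : (k, i, j) ∈ T)
    (hl : (l, j, i) ∈ T) : k ≠ l := by
  rintro rfl
  exact (hT.subset _ hk).2.2.2.2.2.2
    (hT.match_unique hk hl (Or.inl rfl) (Or.inr rfl)).1

/-- The effect of a home-away swap on the play vector. -/
theorem IsTournament.play_sub_play_swapHome (hT : IsTournament n T) {k l i j : ℕ}
    (hk : (k, i, j) ∈ T) (hl : (l, j, i) ∈ T) (m : ℕ × ℕ × ℕ) :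
    play T m - play (TTP.swapHome k l i j T) m =
      ((if m = (l, j, i) then 1 else 0) - (if m = (l, i, j) then 1 else 0)) -
      ((if m = (k, j, i) then 1 else 0) - (if m = (k, i, j) then 1 else 0)) := by
  have hij : i ≠ j := (hT.subset _ hk).2.2.2.2.2.2
  have hkl := hT.slots_ne hk hl
  have hk' : (k, j, i) ∉ T := fun h => hkl (hT.slot_unique h hl)
  have hl' : (l, i, j) ∉ T := fun h => hkl (hT.slot_unique hk h)
  obtain ⟨s, a, b⟩ := m
  simp only [play, TTP.swapHome, Set.mem_ofPred_eq]
  by_cases hab : a = i ∧ b = j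
  · obtain ⟨rfl, rfl⟩ := hab
    by_cases h1 : s = k
    · subst h1; simp [hk, hk', hij, hkl]
    by_cases h2 : s = l
    · subst h2; simp [hl, hl', hij, h1]
    · simp [h1, h2]
  by_cases hab' : a = j ∧ b = i
  · obtain ⟨rfl, rfl⟩ := hab'
    by_cases h1 : s = k
    · subst h1; simp [hk, hk', hij, hkl]
    by_cases h2 : s = l
    · subst h2; simp [hl, hl', hij, h1]
    · simp [h1, h2]
  · simp [hab, hab']

theorem mem_of_venue_eq {t s v : ℕ} (h : venue T t s = v) (hv : v ≠ t) : (s, v, t) ∈ T := by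
  unfold venue at h
  split_ifs at h with hex
  · obtain ⟨j, hj, hj'⟩ := hex.choose_spec
    rw [h] at hj hj'
    rcases hj' with rfl | rfl
    · exact absurd rfl hv
    · exact hj
  · exact absurd h.symm hv

theorem IsTournament.venue_eq (hT : IsTournament n T) {t s v : ℕ} (h : (s, v, t) ∈ T) :
    venue T t s = v := by
  have hex : ∃ i, ∃ j, (s, i, j) ∈ T ∧ (t = i ∨ t = j) := ⟨v, t, h, Or.inr rfl⟩
  unfold venue
  rw [dif_pos hex]
  obtain ⟨j, hj, hj'⟩ := hex.choose_spec
  exact (hT.match_unique hj h hj' (Or.inr rfl)).1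

/-- Slots can be permuted to put two matches of different slots into prescribed slots. -/
theorem IsTournament.exists_place (hT : IsTournament n T) {s s' a b c d p q : ℕ}
    (hs : (s, a, b) ∈ T) (hs' : (s', c, d) ∈ T) (hss : s ≠ s') (hpq : p ≠ q)
    (hp : 1 ≤ p) (hp' : p ≤ 2 * n - 2) (hq : 1 ≤ q) (hq' : q ≤ 2 * n - 2) :
    ∃ T', IsTournament n T' ∧ (p, a, b) ∈ T' ∧ (q, c, d) ∈ T' := by
  have hsr := hT.subset _ hs
  have h1 := hT.swapSlots hsr.1 hsr.2.1 hp hp'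
  have h2 : (p, a, b) ∈ TTP.swapSlots s p T := by simpa [mem_swapSlots] using hs
  have h3 : (Equiv.swap s p s', c, d) ∈ TTP.swapSlots s p T := by simpa [mem_swapSlots] using hs'
  have hne : Equiv.swap s p s' ≠ p := by
    rw [Ne, Equiv.swap_apply_eq_iff, Equiv.swap_apply_right]
    exact hss.symm
  have h3r := h1.subset _ h3
  refine ⟨_, h1.swapSlots h3r.1 h3r.2.1 hq hq', ?_, ?_⟩
  · rw [mem_swapSlots, Equiv.swap_apply_of_ne_of_ne hne.symm hpq]
    exact h2
  · rw [mem_swapSlots, Equiv.swap_apply_right]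
    exact h3

/-- The slot of the circle method, in `1, …, n - 1`, in which two distinct teams meet. -/
def circleSlot (n i j : ℕ) : ℕ :=
  let s := if i = n then 2 * j else if j = n then 2 * i else i + j
  if s ≤ n - 1 then s else s - (n - 1)

theorem exists_circleSlot_eq (heven : Even n) {r t : ℕ} (hr : 1 ≤ r) (hr' : r ≤ n - 1)
    (ht : 1 ≤ t) (ht' : t ≤ n) :
    ∃ o, 1 ≤ o ∧ o ≤ n ∧ o ≠ t ∧ circleSlot n t o = r ∧ circleSlot n o t = r ∧
      ∀ o', 1 ≤ o' → o' ≤ n → o' ≠ t → circleSlot n t o' = r ∨ circleSlot n o' t = r → o' = o := by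
  obtain ⟨h, rfl⟩ := heven
  unfold circleSlot
  dsimp only
  by_cases htn : t = h + h
  · refine ⟨if r % 2 = 0 then r / 2 else (r + (h + h - 1)) / 2, ?_, ?_, ?_, ?_, ?_, ?_⟩
    all_goals grind
  · by_cases h1 : (if t < r then r - t else r + (h + h - 1) - t) = t
    · refine ⟨h + h, ?_, ?_, ?_, ?_, ?_, ?_⟩
      all_goals grind
    · refine ⟨if t < r then r - t else r + (h + h - 1) - t, ?_, ?_, ?_, ?_, ?_, ?_⟩
      all_goals grind

theorem circleSlot_comm (i j : ℕ) : circleSlot n i j = circleSlot n j i := by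
  unfold circleSlot
  grind

theorem circleSlot_mem {i j : ℕ} (hi : 1 ≤ i) (hi' : i ≤ n) (hj : 1 ≤ j) (hj' : j ≤ n)
    (hij : i ≠ j) : 1 ≤ circleSlot n i j ∧ circleSlot n i j ≤ n - 1 := by
  unfold circleSlot
  dsimp only
  split_ifs <;> omega

/-- The double round-robin tournament given by the circle method. -/
theorem exists_isTournament (heven : Even n) : ∃ T, IsTournament n T := by
  refine ⟨{m | IsMatch n m ∧ m.1 = circleSlot n m.2.1 m.2.2 +
    if m.2.1 < m.2.2 then 0 else n - 1}, fun m hm => hm.1, ?_, ?_⟩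
  · intro k hk hk' t ht ht'
    obtain ⟨o, ho, ho', hot, h1, h2, huniq⟩ := exists_circleSlot_eq heven
      (r := if k ≤ n - 1 then k else k - (n - 1)) (by split_ifs <;> omega)
      (by split_ifs <;> omega) ht ht'
    have key : ∀ a b, a < b → 1 ≤ a → b ≤ n →
        circleSlot n a b = (if k ≤ n - 1 then k else k - (n - 1)) →
        (∀ c d, 1 ≤ c → c ≤ n → 1 ≤ d → d ≤ n → c ≠ d → (t = c ∨ t = d) →
          circleSlot n c d = (if k ≤ n - 1 then k else k - (n - 1)) →
          (c = a ∧ d = b) ∨ (c = b ∧ d = a)) → (t = a ∨ t = b) →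
        ∃! m : ℕ × ℕ × ℕ, m ∈ {m : ℕ × ℕ × ℕ | IsMatch n m ∧
          m.1 = circleSlot n m.2.1 m.2.2 + if m.2.1 < m.2.2 then 0 else n - 1} ∧
          m.1 = k ∧ (t = m.2.1 ∨ t = m.2.2) := by
      intro a b hab ha hb hc hu htab
      have ha' : a ≤ n := hab.le.trans hb
      have hb' : 1 ≤ b := ha.trans hab.le
      refine ⟨if k ≤ n - 1 then (k, a, b) else (k, b, a), ?_, ?_⟩
      · split_ifs at hc ⊢ with hkn
        · refine ⟨⟨⟨hk, hk', ha, ha', hb', hb, hab.ne⟩, ?_⟩, rfl, htab⟩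
          simp [hab, hc]
        · refine ⟨⟨⟨hk, hk', hb', hb, ha, ha', hab.ne'⟩, ?_⟩, rfl, htab.symm⟩
          simp only [circleSlot_comm b a, hc, not_lt_of_gt hab, if_false]
          omega
      · rintro ⟨k', c, d⟩ ⟨⟨⟨-, -, g1, g2, g3, g4, g5⟩, g6⟩, rfl, g7⟩
        dsimp only at *
        have hcr := circleSlot_mem g1 g2 g3 g4 g5
        have := hu c d g1 g2 g3 g4 g5 g7 (by split_ifs at g6 ⊢ <;> omega)
        grind
    rcases lt_or_gt_of_ne hot with hlt | hlt
    · refine key o t hlt ho ht' h2 ?_ (Or.inr rfl)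
      rintro c d g1 g2 g3 g4 g5 (rfl | rfl) g7
      · exact Or.inr ⟨rfl, huniq d g3 g4 g5.symm (Or.inl g7)⟩
      · exact Or.inl ⟨huniq c g1 g2 g5 (Or.inr g7), rfl⟩
    · refine key t o hlt ht ho' h1 ?_ (Or.inl rfl)
      rintro c d g1 g2 g3 g4 g5 (rfl | rfl) g7
      · exact Or.inl ⟨rfl, huniq d g3 g4 g5.symm (Or.inl g7)⟩
      · exact Or.inr ⟨huniq c g1 g2 g5 (Or.inr g7), rfl⟩
  · intro i j h1 h2 h3 h4 h5
    refine ⟨circleSlot n i j + if i < j then 0 else n - 1, ⟨⟨?_, ?_, h1, h2, h3, h4, h5⟩, rfl⟩,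
      fun k hk => hk.2⟩
    all_goals
      have := circleSlot_mem h1 h2 h3 h4 h5
      dsimp only
      split_ifs <;> omega

theorem exists_isTournament_mem_mem (heven : Even n) {i j k l : ℕ} (hk : IsMatch n (k, i, j))
    (hl : 1 ≤ l) (hl' : l ≤ 2 * n - 2) (hkl : k ≠ l) :
    ∃ T, IsTournament n T ∧ (k, i, j) ∈ T ∧ (l, j, i) ∈ T := by
  obtain ⟨T, hT⟩ := exists_isTournament heven
  obtain ⟨h1, h2, h3, h4, h5, h6, h7⟩ := hk
  obtain ⟨s, hs, -⟩ := hT.pair i j h3 h4 h5 h6 h7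
  obtain ⟨s', hs', -⟩ := hT.pair j i h5 h6 h3 h4 h7.symm
  exact hT.exists_place hs hs' (hT.slots_ne hs hs') hkl h1 h2 hl hl'

/-- Team `t` can visit `a` and `b` in prescribed slots while a match in another slot is avoided. -/
theorem exists_isTournament_notMem (hn : 4 ≤ n) (heven : Even n) {p q a b t k i j : ℕ}
    (hp : IsMatch n (p, a, t)) (hq : IsMatch n (q, b, t)) (hm : IsMatch n (k, i, j))
    (hab : a ≠ b) (hpq : p ≠ q) (hkp : k ≠ p) (hkq : k ≠ q) :
    ∃ T, IsTournament n T ∧ (p, a, t) ∈ T ∧ (q, b, t) ∈ T ∧ (k, i, j) ∉ T := by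
  obtain ⟨T₀, hT₀⟩ := exists_isTournament heven
  obtain ⟨h1, h2, h3, h4, h5, h6, h7⟩ := hp
  obtain ⟨g1, g2, g3, g4, g5, g6, g7⟩ := hq
  obtain ⟨s, hs, -⟩ := hT₀.pair a t h3 h4 h5 h6 h7
  obtain ⟨s', hs', -⟩ := hT₀.pair b t g3 g4 g5 g6 g7
  have hss : s ≠ s' := by
    rintro rfl
    exact hab (hT₀.match_unique hs hs' (Or.inr rfl) (Or.inr rfl)).1
  obtain ⟨T, hT, hTp, hTq⟩ := hT₀.exists_place hs hs' hss hpq h1 h2 g1 g2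
  by_cases hmT : (k, i, j) ∈ T
  · obtain ⟨l, hl, hl', hlp, hlq, hlk⟩ :
        ∃ l, 1 ≤ l ∧ l ≤ 2 * n - 2 ∧ l ≠ p ∧ l ≠ q ∧ l ≠ k := by
      by_contra! hcon
      have c1 := hcon 1; have c2 := hcon 2; have c3 := hcon 3; have c4 := hcon 4
      omega
    refine ⟨_, hT.swapSlots hm.1 hm.2.1 hl hl', ?_, ?_, ?_⟩
    · rwa [mem_swapSlots, Equiv.swap_apply_of_ne_of_ne hkp.symm hlp.symm]
    · rwa [mem_swapSlots, Equiv.swap_apply_of_ne_of_ne hkq.symm hlq.symm]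
    · rw [mem_swapSlots, Equiv.swap_apply_left]
      exact fun h => hlk (hT.slot_unique h hmT)
  · exact ⟨T, hT, hTp, hTq, hmT⟩

/-- Any single travel can be avoided by a tournament that also avoids a given match. -/
theorem exists_isTournament_travel_eq_zero (hn : 4 ≤ n) (heven : Even n) {m p : ℕ × ℕ × ℕ}
    (hm : IsMatch n m) (hp : IsTravelIdx n p) :
    ∃ T, IsTournament n T ∧ m ∉ T ∧ travel n T p = 0 := by
  obtain ⟨k, i, j⟩ := m
  obtain ⟨t, v, w⟩ := p
  obtain ⟨h1, h2, h3, h4, h5, h6, h7⟩ := hp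
  dsimp only at *
  obtain ⟨q, hq, hq', hkq, hkq'⟩ : ∃ q, 1 ≤ q ∧ q + 1 ≤ 2 * n - 2 ∧ k ≠ q ∧ k ≠ q + 1 := by
    by_cases hk : k ≤ 2
    · exact ⟨3, by omega⟩
    · exact ⟨1, by omega⟩
  obtain ⟨c, hc, hc', hcv, hcw, hct⟩ : ∃ c, 1 ≤ c ∧ c ≤ n ∧ c ≠ v ∧ c ≠ w ∧ c ≠ t := by
    by_contra! hcon
    have c1 := hcon 1; have c2 := hcon 2; have c3 := hcon 3; have c4 := hcon 4
    omega
  by_cases htw : t = w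
  · subst htw
    obtain ⟨T, hT, hTv, hTc, hTm⟩ := exists_isTournament_notMem hn heven (p := q) (q := q + 1)
      (a := v) (b := c) (t := t) ⟨hq, by dsimp only; omega, h3, h4, h1, h2, h7⟩
      ⟨by dsimp only; omega, hq', hc, hc', h1, h2, hct⟩ hm hcv.symm (by omega) hkq hkq'
    refine ⟨T, hT, hTm, if_neg ?_⟩
    rintro ⟨s, -, hs, hs'⟩
    obtain rfl := hT.slot_unique (mem_of_venue_eq hs h7) hTv
    exact hct ((hT.venue_eq hTc).symm.trans hs')
  · obtain ⟨T, hT, hTc, hTw, hTm⟩ := exists_isTournament_notMem hn heven (p := q) (q := q + 1)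
      (a := c) (b := w) (t := t) ⟨hq, by dsimp only; omega, hc, hc', h1, h2, hct⟩
      ⟨by dsimp only; omega, hq', h5, h6, h1, h2, Ne.symm htw⟩ hm hcw (by omega) hkq hkq'
    refine ⟨T, hT, hTm, if_neg ?_⟩
    rintro ⟨s, -, hs, hs'⟩
    have := hT.slot_unique (mem_of_venue_eq hs' (Ne.symm htw)) hTw
    obtain rfl : s = q := by omega
    exact hcv ((hT.venue_eq hTc).symm.trans hs)

end Tournaments

section Polytope

variable {n : ℕ}

/-- The set of points whose convex hull is `Ptt n`. -/
def vertices (n : ℕ) : Set (Pt n) :=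
  { z : Pt n | ∃ T : Set (ℕ × ℕ × ℕ), IsTournament n T ∧
    (∀ m : {m : ℕ × ℕ × ℕ // IsMatch n m}, z.1 m = play T m.1) ∧
    (∀ p : {p : ℕ × ℕ × ℕ // IsTravelIdx n p}, z.2 p = 0 ∨ z.2 p = 1) ∧
    (∀ p : {p : ℕ × ℕ × ℕ // IsTravelIdx n p}, travel n T p.1 ≤ z.2 p) }

theorem Ptt_eq : Ptt n = convexHull ℝ (vertices n) := rfl

theorem vertices_subset : vertices n ⊆ Ptt n := subset_convexHull ℝ _

/-- The point with play vector `χ(T)` and travel part `y`. -/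
noncomputable def pt (n : ℕ) (T : Set (ℕ × ℕ × ℕ)) (y : {p : ℕ × ℕ × ℕ // IsTravelIdx n p} → ℝ) :
    Pt n :=
  (fun m => play T m.1, y)

theorem travel_le_one (T : Set (ℕ × ℕ × ℕ)) (p : ℕ × ℕ × ℕ) : travel n T p ≤ 1 := by
  unfold travel
  split_ifs <;> norm_num

theorem pt_one_mem {T : Set (ℕ × ℕ × ℕ)} (hT : IsTournament n T) : pt n T 1 ∈ vertices n :=
  ⟨T, hT, fun _ => rfl, fun _ => Or.inr rfl, fun p => travel_le_one T p.1⟩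

/-- The face of `Ptt n` of points that do not use the match `m`. -/
def avoidingFace (m : {m : ℕ × ℕ × ℕ // IsMatch n m}) : Set (Pt n) :=
  {z ∈ Ptt n | z.1 m = 0}

theorem pt_one_mem_avoidingFace {m : {m : ℕ × ℕ × ℕ // IsMatch n m}} {T : Set (ℕ × ℕ × ℕ)}
    (hT : IsTournament n T) (hm : m.1 ∉ T) : pt n T 1 ∈ avoidingFace m :=
  ⟨vertices_subset (pt_one_mem hT), if_neg hm⟩

theorem finite_isTravelIdx : Finite {p : ℕ × ℕ × ℕ // IsTravelIdx n p} := by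
  refine Set.Finite.subset (Set.finite_Icc ((0, 0, 0) : ℕ × ℕ × ℕ) (n, n, n)) ?_
  rintro ⟨a, b, c⟩ ⟨-, h1, -, h2, -, h3, -⟩
  exact ⟨⟨Nat.zero_le _, Nat.zero_le _, Nat.zero_le _⟩, h1, h2, h3⟩

/-- The travel coordinates are unconstrained in the direction of the face. -/
theorem travel_mem_vectorSpan (hn : 4 ≤ n) (heven : Even n)
    (m : {m : ℕ × ℕ × ℕ // IsMatch n m}) (v : {p : ℕ × ℕ × ℕ // IsTravelIdx n p} → ℝ) :
    ((0, v) : Pt n) ∈ vectorSpan ℝ (avoidingFace m) := by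
  have := finite_isTravelIdx (n := n)
  have := Fintype.ofFinite {p : ℕ × ℕ × ℕ // IsTravelIdx n p}
  have hsingle : ∀ p, ((0, Pi.single p 1) : Pt n) ∈ vectorSpan ℝ (avoidingFace m) := by
    intro p
    obtain ⟨T, hT, hmT, hp⟩ := exists_isTournament_travel_eq_zero hn heven m.2 p.2
    have hmem : pt n T (1 - Pi.single p 1) ∈ avoidingFace m := by
      refine ⟨vertices_subset ⟨T, hT, fun _ => rfl, fun q => ?_, fun q => ?_⟩, if_neg hmT⟩
      · by_cases hqp : q = p
        · subst hqp; simp [pt]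
        · simp [pt, hqp]
      · by_cases hqp : q = p
        · subst hqp; simp [pt, hp]
        · simpa [pt, hqp] using travel_le_one T q.1
    have := vsub_mem_vectorSpan ℝ (pt_one_mem_avoidingFace hT hmT) hmem
    simpa [pt] using this
  have hsum : ((0, v) : Pt n) = ∑ p, v p • ((0, Pi.single p 1) : Pt n) := by
    refine Prod.ext ?_ ?_
    · simp [Prod.fst_sum]
    · ext q
      simp [Prod.snd_sum, Finset.sum_apply, Pi.single_apply]
  rw [hsum]
  exact Submodule.sum_mem _ fun p _ => Submodule.smul_mem _ _ (hsingle p)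

/-- The difference of the two orientations of a match between `i` and `j` in slot `l`. -/
noncomputable def orientationDiff (n l i j : ℕ) : Pt n :=
  (fun m => (if m.1 = (l, j, i) then 1 else 0) - (if m.1 = (l, i, j) then 1 else 0), 0)

theorem pt_sub_pt_swapHome {T : Set (ℕ × ℕ × ℕ)} (hT : IsTournament n T) {k l i j : ℕ}
    (hk : (k, i, j) ∈ T) (hl : (l, j, i) ∈ T) :
    pt n T 1 - pt n (swapHome k l i j T) 1 = orientationDiff n l i j - orientationDiff n k i j := by
  refine Prod.ext ?_ ?_
  · ext m
    exact hT.play_sub_play_swapHome hk hl m.1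
  · simp [pt, orientationDiff]

theorem notMem_swapHome {T : Set (ℕ × ℕ × ℕ)} (hT : IsTournament n T) {k l i j : ℕ}
    (hk : (k, i, j) ∈ T) (hl : (l, j, i) ∈ T) : (k, i, j) ∉ swapHome k l i j T := by
  intro h
  simp only [swapHome, Set.mem_ofPred_eq, true_or, and_self, if_true, Prod.swap_prod_mk] at h
  exact hT.slots_ne hk hl (hT.slot_unique h hl)

theorem orientationDiff_sub_mem_vectorSpan (heven : Even n) {k i j : ℕ} (hm : IsMatch n (k, i, j))
    {l l' : ℕ} (hl : 1 ≤ l) (hln : l ≤ 2 * n - 2) (hl' : 1 ≤ l') (hln' : l' ≤ 2 * n - 2)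
    (hlk : l ≠ k) (hlk' : l' ≠ k) :
    orientationDiff n l i j - orientationDiff n l' i j ∈
      vectorSpan ℝ (avoidingFace ⟨(k, i, j), hm⟩) := by
  by_cases hll : l' = l
  · subst hll; simp
  obtain ⟨T, hT, h1, h2⟩ := exists_isTournament_mem_mem heven
    (i := i) (j := j) (k := l') (l := l) ⟨hl', hln', hm.2.2⟩ hl hln hll
  rw [← pt_sub_pt_swapHome hT h1 h2]
  refine vsub_mem_vectorSpan ℝ (pt_one_mem_avoidingFace hT ?_)
    (pt_one_mem_avoidingFace (hT.swapHome h1 h2) ?_)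
  · exact fun h => hlk' (hT.slot_unique h1 h)
  · intro h
    simp only [swapHome, Set.mem_ofPred_eq, hlk.symm, hlk'.symm, or_self, false_and, if_false] at h
    exact hlk' (hT.slot_unique h1 h)

theorem fst_eq_zero_of_mem_vectorSpan {m : {m : ℕ × ℕ × ℕ // IsMatch n m}} {z : Pt n}
    (hz : z ∈ vectorSpan ℝ (avoidingFace m)) : z.1 m = 0 := by
  have hle : vectorSpan ℝ (avoidingFace m) ≤
      LinearMap.ker ((LinearMap.proj m).comp (LinearMap.fst ℝ ({m // IsMatch n m} → ℝ)
        ({p // IsTravelIdx n p} → ℝ))) := by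
    refine Submodule.span_le.2 ?_
    rintro _ ⟨a, ha, b, hb, rfl⟩
    simp [ha.2, hb.2]
  simpa using hle hz

theorem finite_isMatch : Finite {m : ℕ × ℕ × ℕ // IsMatch n m} := by
  refine Set.Finite.subset (Set.finite_Icc ((0, 0, 0) : ℕ × ℕ × ℕ) (2 * n - 2, n, n)) ?_
  rintro ⟨a, b, c⟩ ⟨-, h1, -, h2, -, h3, -⟩
  exact ⟨⟨Nat.zero_le _, Nat.zero_le _, Nat.zero_le _⟩, h1, h2, h3⟩

theorem finiteDimensional_Pt : FiniteDimensional ℝ (Pt n) := by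
  have := finite_isMatch (n := n)
  have := finite_isTravelIdx (n := n)
  infer_instance

/-- The direction of `Ptt n` is spanned by that of the face and a single home-away swap. -/
theorem vectorSpan_Ptt (hn : 4 ≤ n) (heven : Even n) {k i j : ℕ} (hm : IsMatch n (k, i, j))
    {l : ℕ} (hl : 1 ≤ l) (hl' : l ≤ 2 * n - 2) (hlk : l ≠ k) :
    vectorSpan ℝ (Ptt n) = vectorSpan ℝ (avoidingFace ⟨(k, i, j), hm⟩) ⊔
      Submodule.span ℝ {orientationDiff n l i j - orientationDiff n k i j} := by
  set D := vectorSpan ℝ (avoidingFace ⟨(k, i, j), hm⟩)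
  obtain ⟨T₀, hT₀, h₀, h₀'⟩ := exists_isTournament_mem_mem heven hm hl hl' hlk.symm
  have hbase := pt_one_mem_avoidingFace (m := ⟨(k, i, j), hm⟩) (hT₀.swapHome h₀ h₀')
    (notMem_swapHome hT₀ h₀ h₀')
  apply le_antisymm
  · have hspan : vectorSpan ℝ (Ptt n) = vectorSpan ℝ (vertices n) := by
      rw [← direction_affineSpan, ← direction_affineSpan, Ptt_eq, affineSpan_convexHull]
    rw [hspan, vectorSpan_eq_span_vsub_set_right ℝ (pt_one_mem (hT₀.swapHome h₀ h₀')),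
      Submodule.span_le]
    rintro _ ⟨z, ⟨T, hT, hz, -⟩, rfl⟩
    obtain ⟨y, hzT⟩ : ∃ y, z = pt n T 1 + (0, y) := by
      refine ⟨z.2 - 1, Prod.ext ?_ ?_⟩
      · ext m
        simpa [pt] using hz m
      · simp [pt]
    have hy := travel_mem_vectorSpan hn heven ⟨(k, i, j), hm⟩ y
    simp only [vsub_eq_sub, SetLike.mem_coe]
    by_cases hkT : (k, i, j) ∈ T
    · have ⟨_, _, h3, h4, h5, h6, h7⟩ := hm
      obtain ⟨s, hs, -⟩ := hT.pair j i h5 h6 h3 h4 h7.symm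
      have hsr := hT.subset _ hs
      have hdiff := pt_sub_pt_swapHome hT hkT hs
      have hmem := pt_one_mem_avoidingFace (m := ⟨(k, i, j), hm⟩) (hT.swapHome hkT hs)
        (notMem_swapHome hT hkT hs)
      have hflip := orientationDiff_sub_mem_vectorSpan heven hm hsr.1 hsr.2.1 hl hl'
        (hT.slots_ne hkT hs).symm hlk
      have hsplit : z - pt n (swapHome k l i j T₀) 1 =
          ((0, y) + (orientationDiff n s i j - orientationDiff n l i j) +
            (pt n (swapHome k s i j T) 1 - pt n (swapHome k l i j T₀) 1)) +
          (orientationDiff n l i j - orientationDiff n k i j) := by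
        rw [hzT, eq_add_of_sub_eq hdiff]
        abel
      rw [hsplit]
      exact Submodule.add_mem_sup
        (D.add_mem (D.add_mem hy hflip) (vsub_mem_vectorSpan ℝ hmem hbase))
        (Submodule.mem_span_singleton_self _)
    · refine Submodule.mem_sup_left ?_
      have hmem := pt_one_mem_avoidingFace (m := ⟨(k, i, j), hm⟩) hT hkT
      have := D.add_mem hy (vsub_mem_vectorSpan ℝ hmem hbase)
      rw [hzT]
      convert this using 1
      simp only [vsub_eq_sub]
      abel
  · refine sup_le (vectorSpan_mono ℝ (Set.sep_subset _ _)) ?_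
    rw [Submodule.span_singleton_le_iff_mem, ← pt_sub_pt_swapHome hT₀ h₀ h₀']
    exact vsub_mem_vectorSpan ℝ (vertices_subset (pt_one_mem hT₀)) hbase.1

theorem fst_nonneg_of_mem_Ptt {z : Pt n} (hz : z ∈ Ptt n) (m : {m : ℕ × ℕ × ℕ // IsMatch n m}) :
    0 ≤ z.1 m := by
  have hconv : Convex ℝ {z : Pt n | 0 ≤ z.1 m} := by
    intro x hx y hy a b ha hb _
    exact add_nonneg (mul_nonneg ha hx) (mul_nonneg hb hy)
  refine convexHull_min ?_ hconv hz
  rintro x ⟨T, -, hx, -⟩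
  rw [Set.mem_ofPred_eq, hx, play]
  split_ifs <;> norm_num

end Polytope

/-- the nonnegativity inequalities `x_{k,i,j} ≥ 0` are facet-defining. -/
theorem nonneg_facet (n : ℕ) (hn : 4 ≤ n) (heven : Even n)
    (k i j : ℕ) (hm : IsMatch n (k, i, j)) :
    IsFacetGE (fun z : Pt n => xval z k i j) 0 := by
  have hx : ∀ z : Pt n, xval z k i j = z.1 ⟨(k, i, j), hm⟩ := fun z => dif_pos hm
  simp only [IsFacetGE, hx]
  refine ⟨fun z hz => fst_nonneg_of_mem_Ptt hz _, ?_⟩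
  obtain ⟨l, hl, hl', hlk⟩ : ∃ l, 1 ≤ l ∧ l ≤ 2 * n - 2 ∧ l ≠ k := by
    by_cases hk : k = 1
    · exact ⟨2, by omega⟩
    · exact ⟨1, by omega⟩
  have hij : i ≠ j := hm.2.2.2.2.2.2
  have := finiteDimensional_Pt (n := n)
  rw [adim, adim, direction_affineSpan, direction_affineSpan,
    vectorSpan_Ptt hn heven hm hl hl' hlk, Submodule.finrank_sup_span_singleton]
  · rfl
  · intro h
    have := fst_eq_zero_of_mem_vectorSpan h
    simp [orientationDiff, hij, hlk.symm] at this

end TTP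
end

section
/- Let T be a tournament and t ∈ V a team that leaves its home venue exactly once, i.e., Σ_{j ∈ V∖{t}} ψ(T)_{t,t,j} = 1. Then the set of slots in which t plays away (i.e., its venue differs from t) is a set of consecutive integers, and consequently for every k ∈ {1,…,n−1}, team t plays at home in exactly one of the two slots k and k+n−1. -/
open Finset

attribute [local instance] Classical.propDecidable

namespace TTP

/-- A bounded nonempty predicate on `ℕ` that fails at `0` and has only one rising edge holds
exactly on an interval. -/
lemma exists_forall_iff_Icc_of_unique_rise (P : ℕ → Prop) (N : ℕ) (h0 : ¬ P 0)
    (hN : ∀ k, P k → k < N) (hex : ∃ k, P k)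
    (huniq : ∀ k l, ¬ P k → P (k + 1) → ¬ P l → P (l + 1) → k = l) :
    ∃ a b, ∀ k, P k ↔ a ≤ k ∧ k ≤ b := by
  have ha : P (Nat.find hex) := Nat.find_spec hex
  have hmin : ∀ m < Nat.find hex, ¬ P m := fun m hm => Nat.find_min hex hm
  generalize Nat.find hex = a at ha hmin
  have hapos : a ≠ 0 := by rintro rfl; exact h0 ha
  have hex' : ∃ c, a < c ∧ ¬ P c := ⟨a + N + 1, by omega, fun h => by have := hN _ h; omega⟩
  obtain ⟨hac, hc⟩ := Nat.find_spec hex'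
  have hcmin : ∀ m < Nat.find hex', ¬ (a < m ∧ ¬ P m) := fun m hm => Nat.find_min hex' hm
  generalize Nat.find hex' = c at hac hc hcmin
  have hafter : ∀ k, c ≤ k → ¬ P k := by
    intro k hk
    induction k, hk using Nat.le_induction with
    | base => exact hc
    | succ k hk ih =>
      intro h
      have hrise : P (a - 1 + 1) := by rwa [Nat.sub_add_cancel (by omega)]
      have := huniq k (a - 1) ih h (hmin _ (by omega)) hrise
      omega
  refine ⟨a, c - 1, fun k => ⟨fun hk => ⟨?_, ?_⟩, fun ⟨h1, h2⟩ => ?_⟩⟩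
  · by_contra h
    exact hmin k (by omega) hk
  · by_contra h
    exact hafter k (by omega) hk
  · rcases h1.eq_or_lt with rfl | h1
    · exact ha
    · by_contra h
      exact hcmin k (by omega) ⟨h1, h⟩

/-- A venue other than its own is the venue of a team exactly when it plays an away match there. -/
lemma IsTournament.venue_eq_iff {n : ℕ} {T : Set (ℕ × ℕ × ℕ)} (hT : IsTournament n T)
    {t i k : ℕ} (hi : i ≠ t) : venue T t k = i ↔ (k, i, t) ∈ T := by
  constructor
  · intro h
    unfold venue at h
    split_ifs at h with hex
    · obtain ⟨j, hj, htj⟩ := hex.choose_spec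
      rw [h] at hj htj
      rcases htj with rfl | rfl
      · exact absurd rfl hi
      · exact hj
    · exact absurd h.symm hi
  · intro h
    have hex : ∃ i, ∃ j, (k, i, j) ∈ T ∧ (t = i ∨ t = j) := ⟨i, t, h, Or.inr rfl⟩
    unfold venue
    rw [dif_pos hex]
    obtain ⟨j, hj, htj⟩ := hex.choose_spec
    have hm := hT.subset _ h
    simp only [IsMatch] at hm
    have := (hT.slot_team k hm.1 hm.2.1 t (by omega) (by omega)).unique
      ⟨hj, rfl, htj⟩ ⟨h, rfl, Or.inr rfl⟩
    exact congrArg (fun m => m.2.1) this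

lemma IsTournament.mem_of_venue_ne {n : ℕ} {T : Set (ℕ × ℕ × ℕ)} (hT : IsTournament n T)
    {t k : ℕ} (h : venue T t k ≠ t) : (k, venue T t k, t) ∈ T :=
  (hT.venue_eq_iff h).1 rfl

lemma IsTournament.isMatch_of_venue_ne {n : ℕ} {T : Set (ℕ × ℕ × ℕ)} (hT : IsTournament n T)
    {t k : ℕ} (h : venue T t k ≠ t) : IsMatch n (k, venue T t k, t) :=
  hT.subset _ (hT.mem_of_venue_ne h)

/-- A team plays away at most once at each venue. -/
lemma IsTournament.eq_of_venue_eq {n : ℕ} {T : Set (ℕ × ℕ × ℕ)} (hT : IsTournament n T)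
    {t k l : ℕ} (hk : venue T t k ≠ t) (hkl : venue T t k = venue T t l) : k = l := by
  have hm := hT.isMatch_of_venue_ne hk
  simp only [IsMatch] at hm
  have hl := hT.mem_of_venue_ne (hkl ▸ hk)
  rw [← hkl] at hl
  exact (hT.pair (venue T t k) t (by omega) (by omega) (by omega) (by omega) hk).unique
    (hT.mem_of_venue_ne hk) hl

/-- A team plays `n - 1` away matches. -/
lemma IsTournament.card_away {n : ℕ} {T : Set (ℕ × ℕ × ℕ)} (hT : IsTournament n T)
    {t : ℕ} (ht1 : 1 ≤ t) (htn : t ≤ n) :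
    #{k ∈ Finset.Icc 1 (2 * n - 2) | venue T t k ≠ t} = n - 1 := by
  have hcard : #(Finset.Icc 1 n \ {t}) = n - 1 := by
    rw [Finset.card_sdiff_of_subset (by simp [ht1, htn])]
    simp
  rw [← hcard]
  refine Finset.card_nbij (venue T t) ?_ ?_ ?_
  · intro k hk
    simp only [Finset.coe_filter, Set.mem_ofPred_eq] at hk
    have := hT.isMatch_of_venue_ne hk.2
    simp only [IsMatch] at this
    simp only [Finset.coe_sdiff, Finset.coe_Icc, Finset.coe_singleton, Set.mem_sdiff, Set.mem_Icc,
      Set.mem_singleton_iff]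
    omega
  · intro k hk l hl hkl
    simp only [Finset.coe_filter, Set.mem_ofPred_eq] at hk
    exact hT.eq_of_venue_eq hk.2 hkl
  · intro i hi
    simp only [Finset.coe_sdiff, Finset.coe_Icc, Finset.coe_singleton, Set.mem_sdiff,
      Set.mem_Icc, Set.mem_singleton_iff] at hi
    obtain ⟨k, hk, -⟩ := hT.pair i t hi.1.1 hi.1.2 ht1 htn hi.2
    have hm := hT.subset _ hk
    simp only [IsMatch] at hm
    have hv := (hT.venue_eq_iff hi.2).2 hk
    refine ⟨k, ?_, hv⟩
    simp only [Finset.coe_filter, Set.mem_ofPred_eq, Finset.mem_Icc, hv]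
    exact ⟨⟨hm.1, hm.2.1⟩, hi.2⟩

/-- A team that leaves home exactly once has a unique slot after which it leaves home. -/
lemma IsTournament.unique_departure {n : ℕ} {T : Set (ℕ × ℕ × ℕ)} (hT : IsTournament n T)
    {t : ℕ} (honce : ∑ j ∈ Finset.Icc 1 n \ {t}, travel n T (t, t, j) = 1) {k l : ℕ}
    (hk : venue T t k = t) (hk' : venue T t (k + 1) ≠ t)
    (hl : venue T t l = t) (hl' : venue T t (l + 1) ≠ t) : k = l := by
  simp only [travel, Finset.sum_boole, Nat.cast_eq_one, Finset.card_eq_one] at honce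
  obtain ⟨i, hi⟩ := honce
  have hmem : ∀ m, venue T t m = t → venue T t (m + 1) ≠ t → venue T t (m + 1) = i := by
    intro m hm hm'
    have h := hT.isMatch_of_venue_ne hm'
    simp only [IsMatch] at h
    rw [← Finset.mem_singleton, ← hi]
    simp only [Finset.mem_filter, Finset.mem_sdiff, Finset.mem_Icc, Finset.mem_singleton]
    exact ⟨⟨by omega, hm'⟩, m, by omega, hm, rfl⟩
  have := hT.eq_of_venue_eq hk' ((hmem k hk hk').trans (hmem l hl hl').symm)
  omega

/-- if team `t` leaves its home venue exactly once, then its away slots are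
consecutive, and for every `k ∈ {1,…,n-1}` it plays at home in exactly one of the slots
`k` and `k+n-1`. -/
theorem away_slots_consecutive (n : ℕ) (hn : 4 ≤ n) (heven : Even n)
    (T : Set (ℕ × ℕ × ℕ)) (hT : IsTournament n T)
    (t : ℕ) (ht1 : 1 ≤ t) (htn : t ≤ n)
    (honce : ∑ j ∈ Finset.Icc 1 n \ {t}, travel n T (t, t, j) = 1) :
    (∃ a b : ℕ, {k : ℕ | 1 ≤ k ∧ k ≤ 2 * n - 2 ∧ venue T t k ≠ t} = Set.Icc a b) ∧
    (∀ k, 1 ≤ k → k ≤ n - 1 →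
      ((venue T t k = t ∧ venue T t (k + n - 1) ≠ t) ∨
       (venue T t k ≠ t ∧ venue T t (k + n - 1) = t))) := by
  have hslot : ∀ k, venue T t k ≠ t → 1 ≤ k ∧ k ≤ 2 * n - 2 := fun k hk => by
    have h := hT.isMatch_of_venue_ne hk
    exact ⟨h.1, h.2.1⟩
  have hcard := hT.card_away ht1 htn
  have hex : ∃ k, venue T t k ≠ t := by
    obtain ⟨k, hk⟩ := Finset.card_pos.1 (hcard ▸ (by omega : 0 < n - 1))
    exact ⟨k, (Finset.mem_filter.1 hk).2⟩
  obtain ⟨a, b, hab⟩ := exists_forall_iff_Icc_of_unique_rise (fun k => venue T t k ≠ t)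
    (2 * n - 1) (fun h => by have := hslot 0 h; omega)
    (fun k hk => by have := hslot k hk; omega) hex
    (fun k l hk hk' hl hl' => hT.unique_departure honce (not_not.1 hk) hk' (not_not.1 hl) hl')
  have hset : {k ∈ Finset.Icc 1 (2 * n - 2) | venue T t k ≠ t} = Finset.Icc a b := by
    ext k
    rw [Finset.mem_filter, Finset.mem_Icc, Finset.mem_Icc, ← hab k]
    exact ⟨fun h => h.2, fun h => ⟨hslot k h, h⟩⟩
  refine ⟨⟨a, b, ?_⟩, fun k hk1 hkn => ?_⟩
  · rw [← Finset.coe_Icc, ← hset]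
    ext k
    simp [and_assoc]
  · rw [hset, Nat.card_Icc] at hcard
    have ha := hslot a ((hab a).2 (by omega))
    have hb := hslot b ((hab b).2 (by omega))
    have h1 := hab k
    have h2 := hab (k + n - 1)
    by_cases hv : venue T t k = t <;> by_cases hw : venue T t (k + n - 1) = t <;>
      simp only [hv, hw, ne_eq, not_true_eq_false, not_false_eq_true, true_iff, false_iff]
        at h1 h2 ⊢ <;>
      simp <;> omega

end TTP
end
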